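/- arXiv:2009.14286 — 2 statements merged into one kernel-verified Lean document; each statement's English description precedes it below -/
import Mathlib

section
/- Let X ∈ ℝ^{n×p}, y ∈ ℝ^n, λ ∈ ℝ and 0 ≤ k ≤ p. Write X_{0:k} for the matrix of the first k columns of X and X_{k:∞} for the matrix of the remaining columns, and set A_k := λI_n + X_{k:∞}X_{k:∞}^⊤. Suppose λI_n + XX^⊤ and A_k are invertible, and let θ̂ := X^⊤(λI_n + XX^⊤)^{−1}y with θ̂_{0:k} its vector of first k coordinates. Then θ̂_{0:k} + X_{0:k}^⊤A_k^{−1}X_{0:k}·θ̂_{0:k} = X_{0:k}^⊤A_k^{−1}y. -/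
open Matrix

noncomputable section

namespace RidgeOverparam

/-- A sum over `Fin p` splits into the first `k` terms and the remaining `p - k`. -/
theorem sum_fin_eq_head_add_tail {M : Type*} [AddCommMonoid M] {p k : ℕ} (hk : k ≤ p)
    (f : Fin p → M) :
    ∑ l, f l = ∑ j : Fin k, f (Fin.castLE hk j) +
      ∑ j : Fin (p - k), f (Fin.cast (Nat.add_sub_cancel' hk) (Fin.natAdd k j)) := by
  rw [← Equiv.sum_comp (finCongr (Nat.add_sub_cancel' hk)), Fin.sum_univ_add]
  rfl

/-- The push-through form of the normal equations: if `(C + B Bᵀ) z = y` with `C` invertible, then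
`(1 + Bᵀ C⁻¹ B) Bᵀ z = Bᵀ C⁻¹ y`. -/
theorem transpose_mulVec_add_of_add_mul_transpose_mulVec_eq {R m l : Type*} [CommRing R]
    [Fintype m] [DecidableEq m] [Fintype l] {C : Matrix m m R} (hC : IsUnit C) (B : Matrix m l R)
    {y z : m → R} (h : (C + B * Bᵀ) *ᵥ z = y) :
    Bᵀ *ᵥ z + (Bᵀ * C⁻¹ * B) *ᵥ (Bᵀ *ᵥ z) = (Bᵀ * C⁻¹) *ᵥ y := by
  have hCC : C⁻¹ * C = 1 := nonsing_inv_mul C ((isUnit_iff_isUnit_det C).1 hC)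
  rw [← h, add_mulVec, mulVec_add, mulVec_mulVec, mulVec_mulVec, mulVec_mulVec,
    Matrix.mul_assoc _ C⁻¹ C, hCC, Matrix.mul_one]
  simp only [Matrix.mul_assoc]

/-- the identity `θ̂_{0:k} + X_{0:k}ᵀ A_k⁻¹ X_{0:k} θ̂_{0:k} = X_{0:k}ᵀ A_k⁻¹ y`
satisfied by the first `k` coordinates of the ridge estimator. -/
theorem ridge_head_coordinates_identity (n p k : ℕ) (hk : k ≤ p)
    (X : Matrix (Fin n) (Fin p) ℝ) (y : Fin n → ℝ) (lam : ℝ) :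
    let X0k : Matrix (Fin n) (Fin k) ℝ := Matrix.of fun i j => X i (Fin.castLE hk j)
    let Xtail : Matrix (Fin n) (Fin (p - k)) ℝ :=
      Matrix.of fun i j => X i ⟨k + (j : ℕ), by have := j.isLt; omega⟩
    let Ak : Matrix (Fin n) (Fin n) ℝ :=
      lam • (1 : Matrix (Fin n) (Fin n) ℝ) + Xtail * Xtailᵀ
    let A : Matrix (Fin n) (Fin n) ℝ :=
      lam • (1 : Matrix (Fin n) (Fin n) ℝ) + X * Xᵀ
    IsUnit A → IsUnit Ak →
    let θhat : Fin p → ℝ := Xᵀ.mulVec (A⁻¹.mulVec y)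
    let θhat0k : Fin k → ℝ := fun j => θhat (Fin.castLE hk j)
    θhat0k + (X0kᵀ * Ak⁻¹ * X0k).mulVec θhat0k = (X0kᵀ * Ak⁻¹).mulVec y := by
  intro X0k Xtail Ak A hA hAk
  have hsplit : A = Ak + X0k * X0kᵀ := by
    have hX : X * Xᵀ = X0k * X0kᵀ + Xtail * Xtailᵀ := by
      ext i j
      exact sum_fin_eq_head_add_tail hk fun l => X i l * X j l
    simp only [A, Ak, hX]
    abel
  refine transpose_mulVec_add_of_add_mul_transpose_mulVec_eq hAk X0k (z := A⁻¹ *ᵥ y) ?_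
  rw [← hsplit, mulVec_mulVec, mul_nonsing_inv A ((isUnit_iff_isUnit_det A).1 hA), one_mulVec]

end RidgeOverparam
end
end

section
/- Let X ∈ ℝ^{n×p}, ε ∈ ℝ^n, λ ∈ ℝ, 0 ≤ k ≤ min(n,p), and let Σ = diag(λ₁,…,λ_p) with λ₁ ≥ … ≥ λ_p > 0, Σ_{0:k} = diag(λ₁,…,λ_k), Σ_{k:∞} = diag(λ_{k+1},…,λ_p). Set A := λI_n + XX^⊤ and A_k := λI_n + X_{k:∞}X_{k:∞}^⊤, and assume A_k is positive definite and X_{0:k} has rank k. Then ‖X^⊤A^{−1}ε‖²_Σ ≤ ( ε^⊤A_k^{−1}X_{0:k}Σ_{0:k}^{−1}X_{0:k}^⊤A_k^{−1}ε ) / ( μ_n(A_k^{−1})²·μ_k(Σ_{0:k}^{−1/2}X_{0:k}^⊤X_{0:k}Σ_{0:k}^{−1/2})² ) + ε^⊤A^{−1}X_{k:∞}Σ_{k:∞}X_{k:∞}^⊤A^{−1}ε. -/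
open Matrix

noncomputable section

namespace RidgeOverparam

/-- The largest eigenvalue of a symmetric matrix, as the supremum of the Rayleigh quotient
over the unit sphere. -/
def muMax {m : ℕ} (M : Matrix (Fin m) (Fin m) ℝ) : ℝ :=
  sSup {r : ℝ | ∃ x : Fin m → ℝ, (∑ i, (x i) ^ 2) = 1 ∧ r = x ⬝ᵥ M.mulVec x}

/-- The smallest eigenvalue of a symmetric matrix, as the infimum of the Rayleigh quotient
over the unit sphere. -/
def muMin {m : ℕ} (M : Matrix (Fin m) (Fin m) ℝ) : ℝ :=
  sInf {r : ℝ | ∃ x : Fin m → ℝ, (∑ i, (x i) ^ 2) = 1 ∧ r = x ⬝ᵥ M.mulVec x}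

theorem bddBelow_rayleigh {m : ℕ} {M : Matrix (Fin m) (Fin m) ℝ} (hM : M.PosSemidef) :
    BddBelow {r : ℝ | ∃ x : Fin m → ℝ, (∑ i, (x i) ^ 2) = 1 ∧ r = x ⬝ᵥ M.mulVec x} := by
  refine ⟨0, ?_⟩
  rintro r ⟨x, -, rfl⟩
  simpa using hM.dotProduct_mulVec_nonneg x

theorem muMin_mul_dotProduct_self_le {m : ℕ} {M : Matrix (Fin m) (Fin m) ℝ}
    (hM : M.PosSemidef) (x : Fin m → ℝ) : muMin M * (x ⬝ᵥ x) ≤ x ⬝ᵥ M.mulVec x := by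
  rcases eq_or_ne x 0 with rfl | hx
  · simp
  have hpos : 0 < x ⬝ᵥ x := lt_of_le_of_ne
    (Finset.sum_nonneg fun i _ => mul_self_nonneg (x i))
    (fun h => hx (dotProduct_self_eq_zero.mp h.symm))
  have hs : Real.sqrt (x ⬝ᵥ x) * Real.sqrt (x ⬝ᵥ x) = x ⬝ᵥ x := Real.mul_self_sqrt hpos.le
  have hle : muMin M ≤ ((Real.sqrt (x ⬝ᵥ x))⁻¹ • x) ⬝ᵥ M.mulVec ((Real.sqrt (x ⬝ᵥ x))⁻¹ • x) := by
    refine csInf_le (bddBelow_rayleigh hM) ⟨_, ?_, rfl⟩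
    have : ∑ i, (((Real.sqrt (x ⬝ᵥ x))⁻¹ • x) i) ^ 2
        = ((Real.sqrt (x ⬝ᵥ x))⁻¹ * (Real.sqrt (x ⬝ᵥ x))⁻¹) * (x ⬝ᵥ x) := by
      simp only [Pi.smul_apply, smul_eq_mul, dotProduct, Finset.mul_sum]
      exact Finset.sum_congr rfl fun i _ => by ring
    rw [this, ← mul_inv, hs, inv_mul_cancel₀ hpos.ne']
  rw [mulVec_smul, dotProduct_smul, smul_dotProduct, smul_eq_mul, smul_eq_mul, ← mul_assoc,
    ← mul_inv, hs] at hle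
  calc muMin M * (x ⬝ᵥ x) ≤ ((x ⬝ᵥ x)⁻¹ * (x ⬝ᵥ M.mulVec x)) * (x ⬝ᵥ x) :=
        mul_le_mul_of_nonneg_right hle hpos.le
    _ = x ⬝ᵥ M.mulVec x := by field_simp

theorem muMin_pos {m : ℕ} (hm : 0 < m) {M : Matrix (Fin m) (Fin m) ℝ} (hM : M.PosDef) :
    0 < muMin M := by
  let S : Set (Fin m → ℝ) := {x | ∑ i, (x i) ^ 2 = 1}
  have hcl : IsClosed S := isClosed_eq (by fun_prop) continuous_const
  have hbd : Bornology.IsBounded S := by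
    refine (Metric.isBounded_closedBall (x := (0 : Fin m → ℝ)) (r := 1)).subset fun x hx => ?_
    rw [mem_closedBall_zero_iff, pi_norm_le_iff_of_nonneg zero_le_one]
    intro i
    rw [Real.norm_eq_abs, ← sq_le_one_iff_abs_le_one, ← show ∑ i, (x i) ^ 2 = 1 from hx]
    exact Finset.single_le_sum (f := fun i => (x i) ^ 2) (fun i _ => sq_nonneg _)
      (Finset.mem_univ i)
  have hne : S.Nonempty := ⟨Pi.single ⟨0, hm⟩ 1, by
    simp [S, Pi.single_apply]⟩
  have hcont : ContinuousOn (fun x : Fin m → ℝ => x ⬝ᵥ M.mulVec x) S := by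
    apply Continuous.continuousOn
    simp only [dotProduct, mulVec]
    fun_prop
  obtain ⟨x, hxS, hx⟩ := (Metric.isCompact_of_isClosed_isBounded hcl hbd).exists_isMinOn hne hcont
  have hx0 : x ≠ 0 := by
    rintro rfl
    simp [S] at hxS
  have hxpos : 0 < x ⬝ᵥ M.mulVec x := by simpa using hM.dotProduct_mulVec_pos hx0
  refine hxpos.trans_le (le_csInf ⟨_, x, hxS, rfl⟩ ?_)
  rintro r ⟨y, hy, rfl⟩
  exact hx hy

theorem sum_fin_eq_sum_castLE_add_sum {p k : ℕ} (hkp : k ≤ p) {M : Type*} [AddCommMonoid M]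
    (f : Fin p → M) :
    ∑ i, f i = (∑ j : Fin k, f (Fin.castLE hkp j)) +
      ∑ j : Fin (p - k), f ⟨k + (j : ℕ), by have := j.isLt; omega⟩ := by
  have h : k + (p - k) = p := by omega
  rw [← Equiv.sum_comp (finCongr h) f, Fin.sum_univ_add]
  rfl

theorem dotProduct_sandwich_mulVec {m l : Type*} [Fintype m] [Fintype l]
    (N : Matrix m l ℝ) (K : Matrix l l ℝ) (x : m → ℝ) :
    x ⬝ᵥ (N * K * Nᵀ).mulVec x = (Nᵀ.mulVec x) ⬝ᵥ K.mulVec (Nᵀ.mulVec x) := by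
  rw [← mulVec_mulVec, ← mulVec_mulVec, dotProduct_mulVec, ← mulVec_transpose]

theorem mulVec_injective_of_rank_eq {n k : ℕ} {Z : Matrix (Fin n) (Fin k) ℝ}
    (hZ : Z.rank = k) : Function.Injective Z.mulVec := by
  have h : LinearMap.ker Z.mulVecLin = ⊥ := by
    have := Z.mulVecLin.finrank_range_add_finrank_ker
    rw [Module.finrank_fin_fun] at this
    have hr : Module.finrank ℝ (LinearMap.range Z.mulVecLin) = k := hZ
    exact Submodule.finrank_eq_zero.mp (by omega)
  exact LinearMap.ker_eq_bot.mp h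

theorem sq_muMin_mul_dotProduct_le {n k : ℕ} {P : Matrix (Fin n) (Fin n) ℝ}
    (hP : P.PosDef) {Z : Matrix (Fin n) (Fin k) ℝ} (hZ : Z.rank = k) {d : Fin k → ℝ}
    (hd : ∀ j, 0 < d j) (ε : Fin n → ℝ) :
    let v := Zᵀ.mulVec ((P + Z * Zᵀ)⁻¹.mulVec ε)
    let R : Matrix (Fin k) (Fin k) ℝ := diagonal fun j => (Real.sqrt (d j))⁻¹
    v ⬝ᵥ (diagonal d).mulVec v ≤
      (ε ⬝ᵥ (P⁻¹ * Z * diagonal (fun j => (d j)⁻¹) * Zᵀ * P⁻¹).mulVec ε) /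
        (muMin P⁻¹ ^ 2 * muMin (R * Zᵀ * Z * R) ^ 2) := by
  intro v R
  rcases Nat.eq_zero_or_pos k with rfl | hk
  · simp [dotProduct, mulVec, Matrix.mul_apply]
  have hPt : (P⁻¹)ᵀ = P⁻¹ := by simpa using hP.inv.isHermitian.eq
  have hA : (P + Z * Zᵀ).PosDef :=
    hP.add_posSemidef (by simpa using posSemidef_self_mul_conjTranspose Z)
  have hdet : IsUnit (P + Z * Zᵀ).det := (isUnit_iff_isUnit_det _).mp hA.isUnit
  have hdetP : IsUnit P.det := (isUnit_iff_isUnit_det _).mp hP.isUnit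
  have hs : ∀ j, Real.sqrt (d j) ≠ 0 := fun j => (Real.sqrt_pos.mpr (hd j)).ne'
  have hss : ∀ j, Real.sqrt (d j) * Real.sqrt (d j) = d j := fun j => Real.mul_self_sqrt (hd j).le
  let w := Zᵀ.mulVec (P⁻¹.mulVec ε)
  let y : Fin k → ℝ := fun j => Real.sqrt (d j) * v j
  let z : Fin k → ℝ := fun j => (Real.sqrt (d j))⁻¹ * w j
  have hRy : R.mulVec y = v := by
    ext j
    simp only [R, mulVec_diagonal, y]
    field_simp [hs j]
  have hvw : v + Zᵀ.mulVec (P⁻¹.mulVec (Z.mulVec v)) = w := by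
    have h1 : P.mulVec ((P + Z * Zᵀ)⁻¹.mulVec ε) + Z.mulVec v = ε := by
      simp only [v]
      rw [mulVec_mulVec _ Z, ← add_mulVec, mulVec_mulVec, mul_nonsing_inv _ hdet, one_mulVec]
    have h2 : (P + Z * Zᵀ)⁻¹.mulVec ε + P⁻¹.mulVec (Z.mulVec v) = P⁻¹.mulVec ε := by
      conv_rhs => rw [← h1]
      rw [mulVec_add, mulVec_mulVec _ P⁻¹ P, nonsing_inv_mul _ hdetP, one_mulVec]
    simp only [w, ← h2, mulVec_add]
    rfl
  have hC : (R * Zᵀ * Z * R).PosDef := by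
    have hRt : Rᴴ = R := by simp [R]
    have hinj : Function.Injective (Z * R).mulVec := by
      intro a b hab
      rw [← mulVec_mulVec, ← mulVec_mulVec] at hab
      have hR := mulVec_injective_of_rank_eq hZ hab
      ext j
      have := congrFun hR j
      simp only [R, mulVec_diagonal] at this
      exact mul_left_cancel₀ (inv_ne_zero (hs j)) this
    have := PosDef.conjTranspose_mul_self (Z * R) hinj
    rwa [conjTranspose_mul, hRt, conjTranspose_eq_transpose_of_trivial, ← Matrix.mul_assoc] at this
  have hn : 0 < n := hk.trans_le (by simpa [hZ] using rank_le_height Z)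
  have ha := muMin_pos hn hP.inv
  have hb := muMin_pos hk hC
  have hCy : y ⬝ᵥ (R * Zᵀ * Z * R).mulVec y = Z.mulVec v ⬝ᵥ Z.mulVec v := by
    have hRt : Rᵀ = R := by simp [R]
    have := dotProduct_sandwich_mulVec R (Zᵀ * Z) y
    rw [hRt, hRy, ← Matrix.mul_assoc] at this
    rw [this, ← mulVec_mulVec, dotProduct_mulVec, vecMul_transpose]
  have hyz : y ⬝ᵥ z = v ⬝ᵥ w := by
    refine Finset.sum_congr rfl fun j _ => ?_
    simp only [y, z]
    field_simp [hs j]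
  have hvZ : v ⬝ᵥ Zᵀ.mulVec (P⁻¹.mulVec (Z.mulVec v)) =
      Z.mulVec v ⬝ᵥ P⁻¹.mulVec (Z.mulVec v) := by
    rw [dotProduct_mulVec, vecMul_transpose]
  have hbound : muMin P⁻¹ * muMin (R * Zᵀ * Z * R) * (y ⬝ᵥ y) ≤ y ⬝ᵥ z := by
    have hvv : 0 ≤ v ⬝ᵥ v := Finset.sum_nonneg fun i _ => mul_self_nonneg (v i)
    have h1 := muMin_mul_dotProduct_self_le hP.inv.posSemidef (Z.mulVec v)
    have h2 := muMin_mul_dotProduct_self_le hC.posSemidef y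
    rw [hCy] at h2
    have h3 := mul_le_mul_of_nonneg_left h2 ha.le
    rw [hyz, ← hvw, dotProduct_add, hvZ]
    linarith
  have hcs : (y ⬝ᵥ z) ^ 2 ≤ (y ⬝ᵥ y) * (z ⬝ᵥ z) := by
    have := Finset.sum_mul_sq_le_sq_mul_sq Finset.univ y z
    simpa only [dotProduct, ← sq] using this
  have hyy : v ⬝ᵥ (diagonal d).mulVec v = y ⬝ᵥ y := by
    refine Finset.sum_congr rfl fun j _ => ?_
    simp only [mulVec_diagonal, y]
    linear_combination (-(v j * v j)) * hss j
  have hzz : ε ⬝ᵥ (P⁻¹ * Z * diagonal (fun j => (d j)⁻¹) * Zᵀ * P⁻¹).mulVec ε = z ⬝ᵥ z := by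
    have h := dotProduct_sandwich_mulVec (P⁻¹ * Z) (diagonal fun j => (d j)⁻¹) ε
    rw [transpose_mul, hPt, ← Matrix.mul_assoc, ← mulVec_mulVec ε Zᵀ] at h
    rw [h]
    refine Finset.sum_congr rfl fun j _ => ?_
    have hinv : (Real.sqrt (d j))⁻¹ * (Real.sqrt (d j))⁻¹ = (d j)⁻¹ := by rw [← mul_inv, hss j]
    simp only [mulVec_diagonal, z]
    linear_combination (-(w j * w j)) * hinv
  rw [hyy, hzz, ← mul_pow, le_div_iff₀ (by positivity)]
  have hy0 : 0 ≤ y ⬝ᵥ y := Finset.sum_nonneg fun i _ => mul_self_nonneg (y i)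
  rcases hy0.eq_or_lt with h0 | h0
  · rw [← h0, zero_mul]
    exact Finset.sum_nonneg fun i _ => mul_self_nonneg (z i)
  · have hab := mul_pos ha hb
    have h4 := (pow_le_pow_left₀ (mul_nonneg hab.le hy0) hbound 2).trans hcs
    refine le_of_mul_le_mul_left ?_ h0
    linarith [h4]

/-- deterministic upper bound on the variance term `‖XᵀA⁻¹ε‖²_Σ`. -/
theorem variance_term_decomposition_bound (n p k : ℕ) (hkn : k ≤ n) (hkp : k ≤ p)
    (X : Matrix (Fin n) (Fin p) ℝ) (ε : Fin n → ℝ) (lam : ℝ)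
    (lambda_ : Fin p → ℝ) (hpos : ∀ i, 0 < lambda_ i) (hanti : Antitone lambda_) :
    let X0k : Matrix (Fin n) (Fin k) ℝ := Matrix.of fun i j => X i (Fin.castLE hkp j)
    let Xtail : Matrix (Fin n) (Fin (p - k)) ℝ :=
      Matrix.of fun i j => X i ⟨k + (j : ℕ), by have := j.isLt; omega⟩
    let Sig0kInv : Matrix (Fin k) (Fin k) ℝ :=
      Matrix.diagonal fun j => (lambda_ (Fin.castLE hkp j))⁻¹
    let Sig0kInvSqrt : Matrix (Fin k) (Fin k) ℝ :=
      Matrix.diagonal fun j => (Real.sqrt (lambda_ (Fin.castLE hkp j)))⁻¹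
    let Sigtail : Matrix (Fin (p - k)) (Fin (p - k)) ℝ :=
      Matrix.diagonal fun j => lambda_ ⟨k + (j : ℕ), by have := j.isLt; omega⟩
    let A : Matrix (Fin n) (Fin n) ℝ := lam • (1 : Matrix (Fin n) (Fin n) ℝ) + X * Xᵀ
    let Ak : Matrix (Fin n) (Fin n) ℝ :=
      lam • (1 : Matrix (Fin n) (Fin n) ℝ) + Xtail * Xtailᵀ
    Ak.PosDef → X0k.rank = k →
    let v : Fin p → ℝ := Xᵀ.mulVec (A⁻¹.mulVec ε)
    v ⬝ᵥ (Matrix.diagonal lambda_).mulVec v ≤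
      (ε ⬝ᵥ (Ak⁻¹ * X0k * Sig0kInv * X0kᵀ * Ak⁻¹).mulVec ε) /
        (muMin (Ak⁻¹) ^ 2 * muMin (Sig0kInvSqrt * X0kᵀ * X0k * Sig0kInvSqrt) ^ 2) +
      ε ⬝ᵥ (A⁻¹ * Xtail * Sigtail * Xtailᵀ * A⁻¹).mulVec ε := by
  intro X0k Xtail Sig0kInv Sig0kInvSqrt Sigtail A Ak hAk hrank v
  have hA : A = Ak + X0k * X0kᵀ := by
    ext i j
    simp only [A, Ak, Matrix.add_apply, Matrix.mul_apply, transpose_apply,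
      sum_fin_eq_sum_castLE_add_sum hkp, X0k, Xtail, of_apply]
    ring
  have hAt : (A⁻¹)ᵀ = A⁻¹ := by
    rw [transpose_nonsing_inv]
    simp [A]
  have htail : ε ⬝ᵥ (A⁻¹ * Xtail * Sigtail * Xtailᵀ * A⁻¹).mulVec ε =
      (Xtailᵀ.mulVec (A⁻¹.mulVec ε)) ⬝ᵥ Sigtail.mulVec (Xtailᵀ.mulVec (A⁻¹.mulVec ε)) := by
    rw [mulVec_mulVec, ← congrArg (Xtailᵀ * ·) hAt, ← transpose_mul, ← dotProduct_sandwich_mulVec,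
      transpose_mul, hAt, Matrix.mul_assoc _ Xtailᵀ]
  have hsplit : v ⬝ᵥ (diagonal lambda_).mulVec v =
      (X0kᵀ.mulVec (A⁻¹.mulVec ε)) ⬝ᵥ
        (diagonal fun j => lambda_ (Fin.castLE hkp j)).mulVec (X0kᵀ.mulVec (A⁻¹.mulVec ε)) +
      (Xtailᵀ.mulVec (A⁻¹.mulVec ε)) ⬝ᵥ Sigtail.mulVec (Xtailᵀ.mulVec (A⁻¹.mulVec ε)) := by
    simp only [dotProduct, mulVec_diagonal, Sigtail]
    exact sum_fin_eq_sum_castLE_add_sum hkp _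
  rw [htail, hsplit, hA]
  gcongr
  exact sq_muMin_mul_dotProduct_le hAk hrank (fun j => hpos _) ε

end RidgeOverparam
end
end
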